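/- arXiv:2203.16227 — 2 statements merged into one kernel-verified Lean document; each statement's English description precedes it below -/
import Mathlib

section
/- Suppose X is a finite set (with the discrete topology). Then for any μ ∈ P(X) and ν ∈ P(Y), every weak solution of the transport problem for (μ,ν) is a strong solution. -/
open MeasureTheory ProbabilityTheory Topology Filter Set Metric
open scoped NNReal ENNReal

noncomputable section

namespace UWOT

/-- The nonnegative part of an extended real, as an extended nonnegative real. -/
def epos (x : EReal) : ℝ≥0∞ := if x = ⊤ then ⊤ else ENNReal.ofReal x.toReal

/-- Integral of an `EReal`-valued function: positive part minus negative part. -/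
def eintegral {α : Type*} [MeasurableSpace α] (μ : Measure α) (g : α → EReal) : EReal :=
  ((∫⁻ x, epos (g x) ∂μ : ℝ≥0∞) : EReal) - ((∫⁻ x, epos (-(g x)) ∂μ : ℝ≥0∞) : EReal)

/-- Integral of a real-valued function, with value `+∞` when the positive part is not
integrable.  This is the integral "understood in `ℝ ∪ {+∞}`". -/
def eintegralR {α : Type*} [MeasurableSpace α] (μ : Measure α) (f : α → ℝ) : EReal :=
  eintegral μ fun x => (f x : EReal)

variable {X Y : Type*}
  [TopologicalSpace X] [PolishSpace X] [MeasurableSpace X] [BorelSpace X]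
  [TopologicalSpace Y] [PolishSpace Y] [MeasurableSpace Y] [BorelSpace Y]

/-- A nonnegative kernel from `X` to `Y` : a measurable family of finite nonnegative
measures on `Y`. -/
def IsKernel (q : X → FiniteMeasure Y) : Prop :=
  Measurable fun x => (q x : Measure Y)

/-- `μ q = ν` : the kernel `q` transports `μ` onto `ν`. -/
def Transports (μ : Measure X) (q : X → FiniteMeasure Y) (ν : Measure Y) : Prop :=
  μ.bind (fun x => (q x : Measure Y)) = ν

/-- The transport cost `I_c(μ,ν)`, an infimum in `ℝ ∪ {+∞}` (it equals `⊤` when no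
admissible kernel exists). -/
def transportCost (c : X → FiniteMeasure Y → ℝ) (μ : Measure X) (ν : Measure Y) : EReal :=
  sInf {r : EReal | ∃ q : X → FiniteMeasure Y,
    IsKernel q ∧ Transports μ q ν ∧ r = eintegralR μ fun x => c x (q x)}

/-- Standing assumptions on the cost function: convexity in the second variable, joint
lower semicontinuity, and the lower bound (LB). -/
structure IsCost (c : X → FiniteMeasure Y → ℝ) : Prop where
  convex : ∀ (x : X) (m₀ m₁ : FiniteMeasure Y) (t : ℝ≥0), t ≤ 1 →
    c x ((1 - t) • m₀ + t • m₁) ≤ (1 - (t : ℝ)) * c x m₀ + (t : ℝ) * c x m₁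
  lsc : LowerSemicontinuous fun p : X × FiniteMeasure Y => c p.1 p.2
  lb : ∃ r₀ r₁ : ℝ, ∀ (x : X) (m : FiniteMeasure Y), r₀ + r₁ * (m.mass : ℝ) ≤ c x m

/-- The topological support of a measure. -/
def msupport {Z : Type*} [TopologicalSpace Z] [MeasurableSpace Z] (μ : Measure Z) : Set Z :=
  {x | ∀ U : Set Z, IsOpen U → x ∈ U → 0 < μ U}

/-- Membership in `Π(≪ μ, ν)`. -/
def MemPiAC (μ : Measure X) (ν : Measure Y) (π : ProbabilityMeasure (X × Y)) : Prop :=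
  (π : Measure (X × Y)).fst ≪ μ ∧ (π : Measure (X × Y)).snd = ν

/-- Membership in `Π(Supp(μ), ν)`. -/
def MemPiSupp (μ : Measure X) (ν : Measure Y) (π : ProbabilityMeasure (X × Y)) : Prop :=
  (π : Measure (X × Y)).fst (msupport μ) = 1 ∧ (π : Measure (X × Y)).snd = ν

variable [Nonempty Y]

/-- The disintegration kernel `π^x` of `π` with respect to its first marginal, as a
finite (probability) measure. -/
def condFM (π : ProbabilityMeasure (X × Y)) (x : X) : FiniteMeasure Y :=
  ⟨(π : Measure (X × Y)).condKernel x, inferInstance⟩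

/-- The measure `(dπ₁/dμ)(x) • π^x`. -/
def fiber (μ : Measure X) (π : ProbabilityMeasure (X × Y)) (x : X) : FiniteMeasure Y :=
  ((π : Measure (X × Y)).fst.rnDeriv μ x).toNNReal • condFM π x

/-- The functional `I_c^μ[π] = ∫ c(x, (dπ₁/dμ)(x) π^x) dμ`, in `ℝ ∪ {+∞}`. -/
def Icmu (c : X → FiniteMeasure Y → ℝ) (μ : Measure X) (π : ProbabilityMeasure (X × Y)) :
    EReal :=
  eintegralR μ fun x => c x (fiber μ π x)

/-- A strong solution of the transport problem. -/
def IsStrongSol (c : X → FiniteMeasure Y → ℝ) (μ : Measure X) (ν : Measure Y)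
    (π : ProbabilityMeasure (X × Y)) : Prop :=
  MemPiAC μ ν π ∧ Icmu c μ π = transportCost c μ ν

/-- A weak solution of the transport problem. -/
def IsWeakSol (c : X → FiniteMeasure Y → ℝ) (μ : Measure X) (ν : Measure Y)
    (π : ProbabilityMeasure (X × Y)) : Prop :=
  ∃ s : ℕ → ProbabilityMeasure (X × Y), (∀ n, MemPiAC μ ν (s n)) ∧
    Tendsto s atTop (𝓝 π) ∧
    Tendsto (fun n => Icmu c μ (s n)) atTop (𝓝 (transportCost c μ ν))

/-- The recession function `c'_∞(x,m) = lim_{λ→∞} c(x, λm)/λ`. -/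
def recession (c : X → FiniteMeasure Y → ℝ) (x : X) (m : FiniteMeasure Y) : EReal :=
  limsup (fun lam : ℝ≥0 => ((c x (lam • m) / (lam : ℝ) : ℝ) : EReal)) atTop

/-- The extended functional `bar I_c^μ[π]`. -/
def barI (c : X → FiniteMeasure Y → ℝ) (μ : Measure X) (π : ProbabilityMeasure (X × Y)) :
    EReal :=
  eintegralR μ (fun x => c x (fiber μ π x)) +
    eintegral ((π : Measure (X × Y)).fst.singularPart μ) (fun x => recession c x (condFM π x))

/-- Assumption (A). -/
def AssumpA (c : X → FiniteMeasure Y → ℝ) : Prop :=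
  ∃ (a : ℕ → C(X, ℝ)) (b : ℕ → C(X × Y, ℝ)),
    ∀ (x : X) (m : FiniteMeasure Y),
      IsLUB (range fun k => (∫ y, b k (x, y) ∂(m : Measure Y)) + a k x) (c x m)

/-- Assumption (B). -/
def AssumpB (c : X → FiniteMeasure Y → ℝ) : Prop :=
  ∀ (x : X) (m : FiniteMeasure Y), m ≠ 0 →
    Tendsto (fun lam : ℝ≥0 => c x (lam • m) / (lam : ℝ)) atTop atTop

/-- Assumption (C). -/
def AssumpC (c : X → FiniteMeasure Y → ℝ) : Prop :=
  (∀ m : FiniteMeasure Y, Continuous fun x : X => c x m) ∧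
  (∀ m : FiniteMeasure Y, Continuous fun x : X => recession c x m) ∧
  (∃ a : ℝ, 0 ≤ a ∧
    ∀ (x : X) (p : FiniteMeasure Y), p.mass = 1 → recession c x p ≤ (a : EReal))

/-- Assumption (Approx). -/
def AssumpApprox (c : X → FiniteMeasure Y → ℝ) : Prop :=
  ∀ (μ : Measure X) (ν : Measure Y), IsProbabilityMeasure μ → IsProbabilityMeasure ν →
    ∀ π : ProbabilityMeasure (X × Y), MemPiSupp μ ν π →
      ∃ s : ℕ → ProbabilityMeasure (X × Y), (∀ n, MemPiAC μ ν (s n)) ∧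
        Tendsto (fun n => Icmu c μ (s n)) atTop (𝓝 (barI c μ π))

/-- The operator `K_c` acting on continuous functions. -/
def Kc (c : X → FiniteMeasure Y → ℝ) (f : Y → ℝ) (x : X) : EReal :=
  ⨅ m : FiniteMeasure Y, (((∫ y, f y ∂(m : Measure Y)) + c x m : ℝ) : EReal)


/-- The integral of an integrable real function is its Bochner integral. -/
theorem eintegralR_eq_integral {α : Type*} [MeasurableSpace α] {μ : Measure α} {f : α → ℝ}
    (hf : Integrable f μ) : eintegralR μ f = ((∫ x, f x ∂μ : ℝ) : EReal) := by
  have hpos : ∫⁻ x, ENNReal.ofReal (f x) ∂μ ≠ ⊤ := hf.lintegral_lt_top.ne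
  have hneg : ∫⁻ x, ENNReal.ofReal (-f x) ∂μ ≠ ⊤ := hf.neg.lintegral_lt_top.ne
  have epos_coe (r : ℝ) : epos (r : EReal) = ENNReal.ofReal r := by simp [epos]
  rw [integral_eq_lintegral_pos_part_sub_lintegral_neg_part hf, EReal.coe_sub,
    EReal.coe_ennreal_toReal hpos, EReal.coe_ennreal_toReal hneg]
  simp only [eintegralR, eintegral, ← EReal.coe_neg, epos_coe]

/-- Over a finite space, the mass of a fiber recovers the measure of a slice. -/
theorem fiber_mul_measure_singleton [Finite X] [DiscreteTopology X] {μ : Measure X}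
    [IsFiniteMeasure μ] {π : ProbabilityMeasure (X × Y)}
    (hac : (π : Measure (X × Y)).fst ≪ μ) (x : X) (A : Set Y) :
    (fiber μ π x : Measure Y) A * μ {x} = (π : Measure (X × Y)) ({x} ×ˢ A) := by
  set ρ : Measure (X × Y) := (π : Measure (X × Y))
  have hfst : ρ.fst {x} = ρ (Prod.fst ⁻¹' {x}) := Measure.fst_apply (measurableSet_singleton x)
  have hsub : ρ ({x} ×ˢ A) ≤ ρ.fst {x} :=
    hfst ▸ measure_mono fun p hp => hp.1
  by_cases hx : μ {x} = 0
  · have h0 := hac hx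
    rw [hx, mul_zero]
    exact (le_antisymm (hsub.trans h0.le) zero_le).symm
  have hd : ρ.fst.rnDeriv μ x * μ {x} = ρ.fst {x} := by
    rw [← Measure.setLIntegral_rnDeriv hac {x}, lintegral_singleton]
  have htop : ρ.fst.rnDeriv μ x ≠ ⊤ := by
    intro h
    rw [h, ENNReal.top_mul hx] at hd
    exact measure_ne_top _ _ hd.symm
  have hfib : (fiber μ π x : Measure Y) A = ρ.fst.rnDeriv μ x * ρ.condKernel x A := by
    change ((ρ.fst.rnDeriv μ x).toNNReal • ρ.condKernel x) A = _
    rw [Measure.smul_apply, ENNReal.smul_def, ENNReal.coe_toNNReal htop, smul_eq_mul]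
  rw [hfib, mul_right_comm, hd]
  by_cases h0 : ρ.fst {x} = 0
  · rw [h0, zero_mul]
    exact (le_antisymm (hsub.trans h0.le) zero_le).symm
  · rw [Measure.condKernel_apply_of_ne_zero h0, ← mul_assoc,
      ENNReal.mul_inv_cancel h0 (measure_ne_top _ _), one_mul]

theorem transports_fiber [Finite X] [DiscreteTopology X] {μ : Measure X} [IsFiniteMeasure μ]
    {ν : Measure Y} {π : ProbabilityMeasure (X × Y)} (h : MemPiAC μ ν π) :
    Transports μ (fiber μ π) ν := by
  have := Fintype.ofFinite X
  ext A hA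
  rw [Measure.bind_apply hA (measurable_of_finite _).aemeasurable, lintegral_fintype, ← h.2,
    Measure.snd_apply hA]
  simp only [fiber_mul_measure_singleton h.1]
  rw [← measure_biUnion_finset]
  · congr 1
    ext p
    simp
  · intro x _ y _ hxy
    exact Set.disjoint_left.2 fun p hp hq => hxy (hp.1.symm.trans hq.1)
  · exact fun x _ => (measurableSet_singleton x).prod hA

theorem Icmu_eq_sum [Fintype X] [DiscreteTopology X] (c : X → FiniteMeasure Y → ℝ)
    (μ : Measure X) [IsFiniteMeasure μ] (π : ProbabilityMeasure (X × Y)) :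
    Icmu c μ π = ((∑ x, μ.real {x} * c x (fiber μ π x) : ℝ) : EReal) := by
  rw [Icmu, eintegralR_eq_integral .of_finite, integral_fintype .of_finite]
  simp only [smul_eq_mul]

theorem integral_fiber [Finite X] [DiscreteTopology X] {μ : Measure X} [IsFiniteMeasure μ]
    {π : ProbabilityMeasure (X × Y)} (hac : (π : Measure (X × Y)).fst ≪ μ) {x : X}
    (hx : μ {x} ≠ 0) {f : Y → ℝ} (hf : Measurable f) :
    ∫ y, f y ∂(fiber μ π x : Measure Y) =
      (μ.real {x})⁻¹ * ∫ p, (Prod.fst ⁻¹' {x}).indicator (fun p => f p.2) p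
        ∂(π : Measure (X × Y)) := by
  have hS : MeasurableSet (Prod.fst ⁻¹' {x} : Set (X × Y)) :=
    measurable_fst (measurableSet_singleton x)
  have hm : μ {x} • (fiber μ π x : Measure Y) =
      ((π : Measure (X × Y)).restrict (Prod.fst ⁻¹' {x})).map Prod.snd := by
    ext A hA
    rw [Measure.smul_apply, smul_eq_mul, mul_comm, fiber_mul_measure_singleton hac,
      Measure.map_apply measurable_snd hA, Measure.restrict_apply (measurable_snd hA)]
    congr 1
    ext p
    simp [and_comm]
  rw [integral_indicator hS,
    ← integral_map measurable_snd.aemeasurable hf.aestronglyMeasurable, ← hm,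
    integral_smul_measure, smul_eq_mul, ← mul_assoc, Measure.real, inv_mul_cancel₀, one_mul]
  exact ENNReal.toReal_ne_zero.2 ⟨hx, measure_ne_top _ _⟩

/-- Over a finite space, weak convergence of couplings implies weak convergence of fibers. -/
theorem tendsto_fiber [Finite X] [DiscreteTopology X] [CompactSpace Y] {μ : Measure X}
    [IsFiniteMeasure μ] {s : ℕ → ProbabilityMeasure (X × Y)} {π : ProbabilityMeasure (X × Y)}
    (hs : Tendsto s atTop (𝓝 π)) (hsac : ∀ n, (s n : Measure (X × Y)).fst ≪ μ)
    (hac : (π : Measure (X × Y)).fst ≪ μ) {x : X} (hx : μ {x} ≠ 0) :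
    Tendsto (fun n => fiber μ (s n) x) atTop (𝓝 (fiber μ π x)) := by
  rw [FiniteMeasure.tendsto_iff_forall_integral_tendsto]
  intro f
  have hS : IsClopen (Prod.fst ⁻¹' {x} : Set (X × Y)) :=
    (isClopen_discrete {x}).preimage continuous_fst
  have hg : Continuous ((Prod.fst ⁻¹' {x}).indicator fun p : X × Y => f p.2) :=
    (f.continuous.comp continuous_snd).indicator (by simp [hS.frontier_eq])
  simp only [integral_fiber hac hx f.continuous.measurable,
    integral_fiber (hsac _) hx f.continuous.measurable]
  exact ((ProbabilityMeasure.tendsto_iff_forall_integral_tendsto.1 hs)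
    (BoundedContinuousFunction.mkOfCompact ⟨_, hg⟩)).const_mul _

set_option linter.unusedSectionVars false in
/-- The set of couplings admissible for a finite first space is weakly sequentially closed. -/
theorem memPiAC_of_tendsto [Finite X] [DiscreteTopology X] {μ : Measure X} {ν : Measure Y}
    {s : ℕ → ProbabilityMeasure (X × Y)} {π : ProbabilityMeasure (X × Y)}
    (hs : Tendsto s atTop (𝓝 π)) (h : ∀ n, MemPiAC μ ν (s n)) : MemPiAC μ ν π := by
  constructor
  · intro A hA
    have hcl : IsClopen (Prod.fst ⁻¹' A : Set (X × Y)) :=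
      (isClopen_discrete A).preimage continuous_fst
    have hlim := ProbabilityMeasure.tendsto_measure_of_null_frontier_of_tendsto' hs
      (E := Prod.fst ⁻¹' A) (by simp [hcl.frontier_eq])
    rw [Measure.fst_apply (Set.toFinite A).measurableSet]
    refine tendsto_nhds_unique hlim ?_
    have hz (n : ℕ) : (s n : Measure (X × Y)) (Prod.fst ⁻¹' A) = 0 := by
      rw [← Measure.fst_apply (Set.toFinite A).measurableSet]
      exact (h n).1 hA
    simp only [hz]
    exact tendsto_const_nhds
  · have hmap := (ProbabilityMeasure.continuous_map
      (continuous_snd : Continuous (Prod.snd : X × Y → Y))).continuousAt.tendsto.comp hs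
    have hconst (n : ℕ) : (s n).map continuous_snd.measurable.aemeasurable =
        (s 0).map continuous_snd.measurable.aemeasurable :=
      Subtype.ext (((h n).2).trans ((h 0).2).symm)
    have heq := tendsto_nhds_unique hmap (tendsto_const_nhds.congr fun n => (hconst n).symm)
    exact (congrArg Subtype.val heq).trans (h 0).2

/-- Theorem `thm:strongfinite`: if `X` is a finite set (with the discrete
topology), every weak solution of the transport problem is a strong solution. -/
theorem weakSol_isStrongSol_of_finite
    [Finite X] [DiscreteTopology X] [CompactSpace Y]
    (c : X → FiniteMeasure Y → ℝ) (hc : IsCost c)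
    (μ : Measure X) (ν : Measure Y)
    [IsProbabilityMeasure μ] [IsProbabilityMeasure ν]
    (π : ProbabilityMeasure (X × Y)) (hπ : IsWeakSol c μ ν π) :
    IsStrongSol c μ ν π := by
  have := Fintype.ofFinite X
  obtain ⟨s, hmem, hs, hcost⟩ := hπ
  have hπmem := memPiAC_of_tendsto hs hmem
  refine ⟨hπmem, le_antisymm ?_ ?_⟩
  · have hlsc (x : X) : ∀ b < c x (fiber μ π x), μ {x} ≠ 0 →
        ∀ᶠ n in atTop, b < c x (fiber μ (s n) x) := fun b hb hx =>
      (tendsto_fiber hs (fun n => (hmem n).1) hπmem.1 hx).eventually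
        ((hc.lsc.comp (by fun_prop : Continuous fun m : FiniteMeasure Y => (x, m))) _ b hb)
    have hsum (ε : ℝ) (hε : 0 < ε) : ∀ᶠ n in atTop,
        (∑ x, μ.real {x} * c x (fiber μ π x)) - ε ≤ ∑ x, μ.real {x} * c x (fiber μ (s n) x) := by
      have hall : ∀ᶠ n in atTop, ∀ x, μ {x} ≠ 0 →
          c x (fiber μ π x) - ε < c x (fiber μ (s n) x) :=
        eventually_all.2 fun x => by
          by_cases hx : μ {x} = 0
          · simp [hx]
          · filter_upwards [hlsc x _ (sub_lt_self _ hε) hx] with n hn _ using hn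
      filter_upwards [hall] with n hn
      have hmass : ∑ x, μ.real {x} * ε = ε := by
        rw [← Finset.sum_mul, sum_measureReal_singleton]
        simp
      calc (∑ x, μ.real {x} * c x (fiber μ π x)) - ε
          = ∑ x, μ.real {x} * (c x (fiber μ π x) - ε) := by
            simp only [mul_sub, Finset.sum_sub_distrib, hmass]
        _ ≤ _ := Finset.sum_le_sum fun x _ => by
            by_cases hx : μ {x} = 0
            · simp [Measure.real, hx]
            · exact mul_le_mul_of_nonneg_left (hn x hx).le measureReal_nonneg
    simp only [Icmu_eq_sum] at hcost ⊢
    refine EReal.ge_of_forall_gt_iff_ge.1 fun z hz => ge_of_tendsto hcost ?_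
    filter_upwards [hsum _ (sub_pos.2 (EReal.coe_lt_coe_iff.1 hz))] with n hn
    exact EReal.coe_le_coe_iff.2 (by simpa using hn)
  · exact sInf_le ⟨fiber μ π, measurable_of_finite _, transports_fiber hπmem, rfl⟩

end UWOT
end
end

section
/- Assume c satisfies Assumption (A), and define bar𝓘_c(μ,ν) = inf_{π ∈ Π(Supp(μ),ν)} bar I_c^μ[π]. Then the functional P(X) × P(Y) → ℝ ∪ {+∞}, (μ,ν) ↦ bar𝓘_c(μ,ν), is lower semicontinuous at every point (μ,ν) with Supp(μ) = X: for every sequence (μₙ,νₙ) converging weakly to (μ,ν), liminf_{n→∞} bar𝓘_c(μₙ,νₙ) ≥ bar𝓘_c(μ,ν). -/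
open MeasureTheory ProbabilityTheory Topology Filter Set Metric
open scoped NNReal ENNReal

noncomputable section

namespace UWOT

variable {X Y : Type*}
  [TopologicalSpace X] [PolishSpace X] [MeasurableSpace X] [BorelSpace X]
  [TopologicalSpace Y] [PolishSpace Y] [MeasurableSpace Y] [BorelSpace Y]

variable [Nonempty Y]

/-- `bar 𝓘_c(μ,ν) = inf { bar I_c^μ[π] : π ∈ Π(Supp(μ), ν) }`. -/
def barTC (c : X → FiniteMeasure Y → ℝ) (μ : Measure X) (ν : Measure Y) : EReal :=
  sInf {r : EReal | ∃ π : ProbabilityMeasure (X × Y), MemPiSupp μ ν π ∧ r = barI c μ π}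

set_option linter.unusedSectionVars false


theorem coe_integral_eq_lintegral_sub {α : Type*} [MeasurableSpace α] {μ : Measure α} {f : α → ℝ}
    (hf : Integrable f μ) :
    ((∫ x, f x ∂μ : ℝ) : EReal) = ((∫⁻ x, ENNReal.ofReal (f x) ∂μ : ℝ≥0∞) : EReal) -
      ((∫⁻ x, ENNReal.ofReal (-f x) ∂μ : ℝ≥0∞) : EReal) := by
  have h1 : ∫⁻ x, ENNReal.ofReal (f x) ∂μ ≠ ⊤ := hf.lintegral_lt_top.ne
  have h2 : ∫⁻ x, ENNReal.ofReal (-f x) ∂μ ≠ ⊤ := hf.neg.lintegral_lt_top.ne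
  rw [integral_eq_lintegral_pos_part_sub_lintegral_neg_part hf, EReal.coe_sub,
    EReal.coe_ennreal_toReal h1, EReal.coe_ennreal_toReal h2]

theorem epos_coe (r : ℝ) : epos (r : EReal) = ENNReal.ofReal r := by
  simp [epos]

theorem eintegral_eq_coe_integral {α : Type*} [MeasurableSpace α] {μ : Measure α} {f : α → ℝ}
    {g : α → EReal} (hf : Integrable f μ) (hfg : ∀ᵐ x ∂μ, g x = f x) :
    eintegral μ g = ((∫ x, f x ∂μ : ℝ) : EReal) := by
  rw [coe_integral_eq_lintegral_sub hf, eintegral]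
  congr 2 <;> refine lintegral_congr_ae ?_
  · filter_upwards [hfg] with x hx
    rw [hx, epos_coe]
  · filter_upwards [hfg] with x hx
    rw [hx, ← EReal.coe_neg, epos_coe]

theorem ofReal_le_epos {r : ℝ} {e : EReal} (h : (r : EReal) ≤ e) : ENNReal.ofReal r ≤ epos e := by
  induction e with
  | bot => simp at h
  | coe s => rw [epos_coe]; exact ENNReal.ofReal_le_ofReal (by exact_mod_cast h)
  | top => simp [epos]

theorem epos_neg_le_ofReal {r : ℝ} {e : EReal} (h : (r : EReal) ≤ e) :
    epos (-e) ≤ ENNReal.ofReal (-r) := by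
  induction e with
  | bot => simp at h
  | coe s =>
    rw [← EReal.coe_neg, epos_coe]
    exact ENNReal.ofReal_le_ofReal (neg_le_neg (by exact_mod_cast h))
  | top => simp [epos]

theorem coe_integral_le_eintegral {α : Type*} [MeasurableSpace α] {μ : Measure α} {f : α → ℝ}
    {g : α → EReal} (hf : Integrable f μ) (hfg : ∀ᵐ x ∂μ, (f x : EReal) ≤ g x) :
    ((∫ x, f x ∂μ : ℝ) : EReal) ≤ eintegral μ g := by
  rw [coe_integral_eq_lintegral_sub hf, eintegral]
  refine EReal.sub_le_sub ?_ ?_ <;> refine EReal.coe_ennreal_le_coe_ennreal_iff.2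
    (lintegral_mono_ae ?_)
  · filter_upwards [hfg] with x hx using ofReal_le_epos hx
  · filter_upwards [hfg] with x hx using epos_neg_le_ofReal hx

/-- The pair `(a, b)` defines an affine function of the second variable below the cost. -/
def AffineMinorant (c : X → FiniteMeasure Y → ℝ) (a : C(X, ℝ)) (b : C(X × Y, ℝ)) : Prop :=
  ∀ (x : X) (m : FiniteMeasure Y), (∫ y, b (x, y) ∂(m : Measure Y)) + a x ≤ c x m

theorem tendsto_coe_nnreal_add_div (s t : ℝ) :
    Tendsto (fun lam : ℝ≥0 => ((s + t / (lam : ℝ) : ℝ) : EReal)) atTop (𝓝 (s : EReal)) := by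
  refine continuous_coe_real_ereal.continuousAt.tendsto.comp ?_
  have h : Tendsto (fun lam : ℝ≥0 => t / (lam : ℝ)) atTop (𝓝 0) :=
    (NNReal.tendsto_coe_atTop.2 tendsto_id).const_div_atTop t
  simpa using h.const_add s

theorem integral_smul_finiteMeasure (lam : ℝ≥0) (m : FiniteMeasure Y) (f : Y → ℝ) :
    ∫ y, f y ∂((lam • m : FiniteMeasure Y) : Measure Y) =
      lam * ∫ y, f y ∂(m : Measure Y) := by
  rw [FiniteMeasure.toMeasure_smul, integral_smul_nnreal_measure]
  rfl

theorem AffineMinorant.le_recession {c : X → FiniteMeasure Y → ℝ} {a : C(X, ℝ)} {b : C(X × Y, ℝ)}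
    (h : AffineMinorant c a b) (x : X) (m : FiniteMeasure Y) :
    ((∫ y, b (x, y) ∂(m : Measure Y) : ℝ) : EReal) ≤ recession c x m := by
  rw [← (tendsto_coe_nnreal_add_div (∫ y, b (x, y) ∂(m : Measure Y)) (a x)).limsup_eq]
  refine limsup_le_limsup ?_
  filter_upwards [eventually_gt_atTop 0] with lam hlam
  have hlam' : (0 : ℝ) < lam := hlam
  have := h x (lam • m)
  rw [integral_smul_finiteMeasure] at this
  refine EReal.coe_le_coe_iff.2 ?_
  rw [le_div_iff₀ hlam']
  field_simp
  linarith

theorem recession_eq_of_isLUB {c : X → FiniteMeasure Y → ℝ} {a : ℕ → C(X, ℝ)}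
    {b : ℕ → C(X × Y, ℝ)} {x : X} {m : FiniteMeasure Y} {s : ℝ}
    (hc : ∀ (x : X) (m : FiniteMeasure Y),
      IsLUB (range fun k => (∫ y, b k (x, y) ∂(m : Measure Y)) + a k x) (c x m))
    (hs : IsLUB (range fun k => ∫ y, b k (x, y) ∂(m : Measure Y)) s) :
    recession c x m = s := by
  apply le_antisymm
  · rw [← (tendsto_coe_nnreal_add_div s (c x 0)).limsup_eq]
    refine limsup_le_limsup ?_
    filter_upwards [eventually_gt_atTop 0] with lam hlam
    have hlam' : (0 : ℝ) < lam := hlam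
    refine EReal.coe_le_coe_iff.2 ?_
    rw [div_le_iff₀ hlam', add_mul, div_mul_cancel₀ _ hlam'.ne']
    refine (hc x (lam • m)).2 ?_
    rintro _ ⟨k, rfl⟩
    have h1 : ∫ y, b k (x, y) ∂(m : Measure Y) ≤ s := hs.1 ⟨k, rfl⟩
    have h2 : a k x ≤ c x 0 := by
      simpa using (hc x 0).1 ⟨k, rfl⟩
    simp only [integral_smul_finiteMeasure]
    nlinarith [mul_le_mul_of_nonneg_left h1 hlam'.le]
  · have hmin (k : ℕ) : AffineMinorant c (a k) (b k) := fun x m => (hc x m).1 ⟨k, rfl⟩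
    refine EReal.ge_of_forall_gt_iff_ge.1 fun z hz => ?_
    obtain ⟨_, ⟨k, rfl⟩, hk, -⟩ := hs.exists_between (EReal.coe_lt_coe_iff.1 hz)
    exact le_trans (EReal.coe_le_coe_iff.2 hk.le) ((hmin k).le_recession x m)

/-- The maximum of two integrable functions is approximated in `L¹` by combinations of them with
continuous weights. -/
theorem exists_continuous_combination_integral_le (σ : Measure X) [IsFiniteMeasure σ]
    {u v : X → ℝ} (hum : Measurable u) (hvm : Measurable v) (hu : Integrable u σ)
    (hv : Integrable v σ) {ε : ℝ} (hε : 0 < ε) :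
    ∃ φ : C(X, ℝ), (∀ x, 0 ≤ φ x) ∧ (∀ x, φ x ≤ 1) ∧
      ∫ x, |max (u x) (v x) - (φ x * u x + (1 - φ x) * v x)| ∂σ ≤ ε := by
  let _ := TopologicalSpace.upgradeIsCompletelyMetrizable X
  set w : X → ℝ≥0∞ := fun x => ENNReal.ofReal |u x - v x| with hw
  have hwm : Measurable w := by fun_prop
  have hwint : Integrable (fun x => |u x - v x|) σ := (hu.sub hv).abs
  have : IsFiniteMeasure (σ.withDensity w) :=
    isFiniteMeasure_withDensity hwint.lintegral_lt_top.ne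
  set A : Set X := {x | v x ≤ u x}
  have hA : MeasurableSet A := measurableSet_le hvm hum
  have hI : Integrable (A.indicator fun _ => (1 : ℝ)) (σ.withDensity w) :=
    (integrable_const 1).indicator hA
  obtain ⟨g, hg, hgint⟩ := hI.exists_boundedContinuous_integral_sub_le hε
  refine ⟨⟨fun x => max 0 (min 1 (g x)), by fun_prop⟩, fun x => le_max_left _ _,
    fun x => max_le zero_le_one (min_le_left _ _), le_trans ?_ hg⟩
  rw [integral_withDensity_eq_integral_toReal_smul hwm (by filter_upwards with x; simp [hw])]
  refine integral_mono_of_nonneg (by filter_upwards with x; positivity) ?_ ?_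
  · exact (integrable_withDensity_iff_integrable_smul' hwm
      (by filter_upwards with x; simp [hw])).1 (hI.sub hgint).norm
  · filter_upwards with x
    have h1 : (w x).toReal = |u x - v x| := by simp [hw]
    simp only [ContinuousMap.coe_mk, h1, smul_eq_mul, Real.norm_eq_abs]
    by_cases hx : x ∈ A
    · have hx' : v x ≤ u x := hx
      rw [indicator_of_mem hx, ← abs_mul, max_eq_left hx']
      have e : u x - (max 0 (min 1 (g x)) * u x + (1 - max 0 (min 1 (g x))) * v x) =
        (u x - v x) * (1 - max 0 (min 1 (g x))) := by ring
      rw [e, abs_mul, abs_mul]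
      refine mul_le_mul_of_nonneg_left ?_ (abs_nonneg _)
      grind
    · have hx' : u x ≤ v x := (not_le.1 hx).le
      rw [indicator_of_notMem hx, ← abs_mul, max_eq_right hx']
      have e : v x - (max 0 (min 1 (g x)) * u x + (1 - max 0 (min 1 (g x))) * v x) =
        (u x - v x) * (0 - max 0 (min 1 (g x))) := by ring
      rw [e, abs_mul, abs_mul]
      refine mul_le_mul_of_nonneg_left ?_ (abs_nonneg _)
      grind

theorem exists_integral_abs_partialSups_sub_le (σ : Measure X) [IsFiniteMeasure σ]
    {S : Set (X → ℝ)} (hm : ∀ g ∈ S, Measurable g) (hi : ∀ g ∈ S, Integrable g σ)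
    (hS : ∀ g ∈ S, ∀ h ∈ S, ∀ φ : C(X, ℝ), (∀ x, 0 ≤ φ x) → (∀ x, φ x ≤ 1) →
      (fun x => φ x * g x + (1 - φ x) * h x) ∈ S)
    {f : ℕ → X → ℝ} (hf : ∀ n, f n ∈ S) (n : ℕ) {ε : ℝ} (hε : 0 < ε) :
    Integrable (partialSups f n) σ ∧
      ∃ g ∈ S, ∫ x, |partialSups f n x - g x| ∂σ ≤ ε := by
  induction n generalizing ε with
  | zero => exact ⟨by simpa using hi _ (hf 0), f 0, hf 0, by simpa using hε.le⟩
  | succ n ih =>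
    obtain ⟨hint, g, hg, hgε⟩ := ih (half_pos hε)
    have hint' : Integrable (partialSups f (n + 1)) σ := by
      rw [partialSups_add_one]
      exact hint.sup (hi _ (hf _))
    obtain ⟨φ, h0, h1, hφ⟩ := exists_continuous_combination_integral_le σ (hm g hg)
      (hm _ (hf (n + 1))) (hi g hg) (hi _ (hf (n + 1))) (half_pos hε)
    refine ⟨hint', _, hS g hg _ (hf (n + 1)) φ h0 h1, ?_⟩
    set k : X → ℝ := fun x => φ x * g x + (1 - φ x) * f (n + 1) x with hk
    have hki : Integrable k σ := hi _ (hS g hg _ (hf (n + 1)) φ h0 h1)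
    have hmax : Integrable (fun x => max (g x) (f (n + 1) x)) σ := (hi g hg).sup (hi _ (hf _))
    have hi1 : Integrable (fun x => |partialSups f n x - g x|) σ := (hint.sub (hi g hg)).abs
    have hi2 : Integrable (fun x => |max (g x) (f (n + 1) x) - k x|) σ := (hmax.sub hki).abs
    calc ∫ x, |partialSups f (n + 1) x - k x| ∂σ
        ≤ ∫ x, (|partialSups f n x - g x| + |max (g x) (f (n + 1) x) - k x|) ∂σ := by
          refine integral_mono (hint'.sub hki).abs (hi1.add hi2) fun x => ?_
          have h := abs_max_sub_max_le_abs (partialSups f n x) (g x) (f (n + 1) x)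
          have e : partialSups f (n + 1) x = max (partialSups f n x) (f (n + 1) x) := by
            rw [partialSups_add_one]; rfl
          simp only [e]
          exact (abs_sub_le _ (max (g x) (f (n + 1) x)) _).trans (by gcongr)
      _ ≤ ε := by
          rw [integral_add hi1 hi2]
          linarith

theorem exists_isLUB_integral_le_of_partialSups {α : Type*} [MeasurableSpace α] {σ : Measure α}
    {f : ℕ → α → ℝ} (hm : ∀ n, Measurable (f n)) (hi : ∀ n, Integrable (partialSups f n) σ) {r : ℝ}
    (hr : ∀ n, ∫ x, partialSups f n x ∂σ ≤ r) :
    ∃ F : α → ℝ, Integrable F σ ∧ ∫ x, F x ∂σ ≤ r ∧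
      ∀ᵐ x ∂σ, IsLUB (range fun n => f n x) (F x) := by
  have hM (n : ℕ) : Measurable (partialSups f n) := by
    induction n with
    | zero => simpa using hm 0
    | succ n ih => rw [partialSups_add_one]; exact ih.sup (hm _)
  have hf0 : Integrable (f 0) σ := by simpa using hi 0
  have hle (n : ℕ) (x : α) : f 0 x ≤ partialSups f n x := le_partialSups_of_le f (Nat.zero_le n) x
  set h : ℕ → α → ℝ≥0∞ := fun n x => ENNReal.ofReal (partialSups f n x - f 0 x)
  have hhm (n : ℕ) : Measurable (h n) := ((hM n).sub (hm 0)).ennreal_ofReal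
  have hmono : Monotone h := fun i j hij x =>
    ENNReal.ofReal_le_ofReal (sub_le_sub_right ((partialSups f).monotone hij x) _)
  have hbound : ∫⁻ x, ⨆ n, h n x ∂σ ≤ ENNReal.ofReal (r - ∫ x, f 0 x ∂σ) := by
    rw [lintegral_iSup hhm hmono]
    refine iSup_le fun n => ?_
    change ∫⁻ x, ENNReal.ofReal ((partialSups f n - f 0) x) ∂σ ≤ _
    rw [← ofReal_integral_eq_lintegral_ofReal ((hi n).sub hf0)
      (by filter_upwards with x; exact sub_nonneg.2 (hle n x)),
      integral_sub' (hi n) hf0]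
    exact ENNReal.ofReal_le_ofReal (sub_le_sub_right (hr n) _)
  have hHm : Measurable fun x => ⨆ n, h n x := Measurable.iSup hhm
  have hfin : ∫⁻ x, ⨆ n, h n x ∂σ ≠ ⊤ := ne_top_of_le_ne_top ENNReal.ofReal_ne_top hbound
  have hHi : Integrable (fun x => (⨆ n, h n x).toReal) σ :=
    integrable_toReal_of_lintegral_ne_top hHm.aemeasurable hfin
  refine ⟨fun x => f 0 x + (⨆ n, h n x).toReal, hf0.add hHi, ?_, ?_⟩
  · rw [integral_add hf0 hHi, integral_toReal hHm.aemeasurable (ae_lt_top hHm hfin)]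
    have h0 : 0 ≤ r - ∫ x, f 0 x ∂σ := by simpa using hr 0
    have := ENNReal.toReal_le_of_le_ofReal h0 hbound
    linarith
  · filter_upwards [ae_lt_top hHm hfin] with x hx
    constructor
    · rintro _ ⟨n, rfl⟩
      have h1 : h n x ≤ ⨆ n, h n x := le_iSup (fun n => h n x) n
      have h2 := (ENNReal.ofReal_le_iff_le_toReal hx.ne).1 h1
      have h3 : f n x ≤ partialSups f n x := le_partialSups f n x
      dsimp only
      linarith
    · intro y hy
      have hy0 : f 0 x ≤ y := hy ⟨0, rfl⟩
      have h1 (n : ℕ) : partialSups f n x ≤ y := by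
        rw [Pi.partialSups_apply]
        exact partialSups_le _ _ _ fun k _ => hy ⟨k, rfl⟩
      have h2 : ⨆ n, h n x ≤ ENNReal.ofReal (y - f 0 x) :=
        iSup_le fun n => ENNReal.ofReal_le_ofReal (sub_le_sub_right (h1 n) _)
      have := ENNReal.toReal_le_of_le_ofReal (sub_nonneg.2 hy0) h2
      linarith

/-- The integral of a continuous function over the fibres of the disintegration of `π`. -/
def condIntegral (π : ProbabilityMeasure (X × Y)) (b : C(X × Y, ℝ)) (x : X) : ℝ :=
  ∫ y, b (x, y) ∂(π : Measure (X × Y)).condKernel x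

theorem integral_condFM (π : ProbabilityMeasure (X × Y)) (b : C(X × Y, ℝ)) (x : X) :
    ∫ y, b (x, y) ∂(condFM π x : Measure Y) = condIntegral π b x :=
  rfl

theorem integral_fiber_s4 (μ : Measure X) (π : ProbabilityMeasure (X × Y)) (b : C(X × Y, ℝ)) (x : X) :
    ∫ y, b (x, y) ∂(fiber μ π x : Measure Y) =
      ((π : Measure (X × Y)).fst.rnDeriv μ x).toReal * condIntegral π b x := by
  rw [fiber, integral_smul_finiteMeasure, integral_condFM]
  rfl

theorem measurable_condIntegral (π : ProbabilityMeasure (X × Y)) (b : C(X × Y, ℝ)) :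
    Measurable (condIntegral π b) :=
  (b.continuous.stronglyMeasurable.integral_kernel_prod_right'
    (κ := (π : Measure (X × Y)).condKernel)).measurable

section Compact

variable [CompactSpace X] [CompactSpace Y]

theorem norm_condIntegral_le (π : ProbabilityMeasure (X × Y)) (b : C(X × Y, ℝ)) (x : X) :
    ‖condIntegral π b x‖ ≤ ‖b‖ := by
  simpa [condIntegral] using norm_integral_le_of_norm_le_const (μ := (π : Measure (X × Y)).condKernel x)
    (f := fun y => b (x, y)) (ae_of_all _ fun y => b.norm_coe_le_norm (x, y))

theorem integrable_condIntegral (π : ProbabilityMeasure (X × Y)) (b : C(X × Y, ℝ))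
    (σ : Measure X) [IsFiniteMeasure σ] : Integrable (condIntegral π b) σ :=
  .of_bound (measurable_condIntegral π b).aestronglyMeasurable ‖b‖
    (ae_of_all _ (norm_condIntegral_le π b))

theorem integrable_rnDeriv_mul_condIntegral (μ : Measure X) [IsFiniteMeasure μ]
    (π : ProbabilityMeasure (X × Y)) (b : C(X × Y, ℝ)) :
    Integrable (fun x => ((π : Measure (X × Y)).fst.rnDeriv μ x).toReal * condIntegral π b x) μ :=
  Measure.integrable_toReal_rnDeriv.mul_bdd (c := ‖b‖) (measurable_condIntegral π b).aestronglyMeasurable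
    (ae_of_all _ (norm_condIntegral_le π b))

theorem _root_.ContinuousMap.integrable_of_compactSpace {Z : Type*} [TopologicalSpace Z]
    [CompactSpace Z] [MeasurableSpace Z] [OpensMeasurableSpace Z] (f : C(Z, ℝ)) (σ : Measure Z)
    [IsFiniteMeasure σ] : Integrable f σ :=
  .of_bound f.continuous.measurable.aestronglyMeasurable ‖f‖ (ae_of_all _ f.norm_coe_le_norm)

theorem integral_eq_integral_rnDeriv_add_integral_singularPart (μ : Measure X) [IsFiniteMeasure μ]
    (π : ProbabilityMeasure (X × Y)) (b : C(X × Y, ℝ)) :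
    ∫ z, b z ∂(π : Measure (X × Y)) =
      (∫ x, ((π : Measure (X × Y)).fst.rnDeriv μ x).toReal * condIntegral π b x ∂μ) +
        ∫ x, condIntegral π b x ∂(π : Measure (X × Y)).fst.singularPart μ := by
  have h1 : ∫ x, condIntegral π b x ∂(π : Measure (X × Y)).fst = ∫ z, b z ∂(π : Measure (X × Y)) :=
    Measure.integral_condKernel (b.integrable_of_compactSpace _)
  have h2 := congrArg (fun m => ∫ x, condIntegral π b x ∂m)
    (Measure.rnDeriv_add_singularPart (π : Measure (X × Y)).fst μ)
  have : IsFiniteMeasure (μ.withDensity ((π : Measure (X × Y)).fst.rnDeriv μ)) :=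
    isFiniteMeasure_withDensity (Measure.lintegral_rnDeriv_lt_top _ _).ne
  rw [← h1, ← h2, integral_add_measure (integrable_condIntegral π b _)
    (integrable_condIntegral π b _), integral_withDensity_eq_integral_toReal_smul
      (Measure.measurable_rnDeriv _ _) (Measure.rnDeriv_lt_top _ _)]
  rfl

theorem AffineMinorant.le_barI {c : X → FiniteMeasure Y → ℝ} {a : C(X, ℝ)} {b : C(X × Y, ℝ)}
    (h : AffineMinorant c a b) (μ : Measure X) [IsFiniteMeasure μ]
    (π : ProbabilityMeasure (X × Y)) :
    (((∫ z, b z ∂(π : Measure (X × Y))) + ∫ x, a x ∂μ : ℝ) : EReal) ≤ barI c μ π := by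
  have hi := integrable_rnDeriv_mul_condIntegral μ π b
  have ha := a.integrable_of_compactSpace μ
  rw [integral_eq_integral_rnDeriv_add_integral_singularPart μ, add_right_comm,
    ← integral_add hi ha, EReal.coe_add]
  refine add_le_add (coe_integral_le_eintegral (hi.add ha) (ae_of_all _ fun x => ?_))
    (coe_integral_le_eintegral (integrable_condIntegral π b _) (ae_of_all _ fun x => ?_))
  · have := h x (fiber μ π x)
    rw [integral_fiber_s4] at this
    exact EReal.coe_le_coe_iff.2 this
  · exact h.le_recession x (condFM π x)

/-- Affine minorants are stable under combinations with continuous weights. -/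
theorem AffineMinorant.combination {c : X → FiniteMeasure Y → ℝ} {a a' : C(X, ℝ)}
    {b b' : C(X × Y, ℝ)} (h : AffineMinorant c a b) (h' : AffineMinorant c a' b') {φ : C(X, ℝ)}
    (h0 : ∀ x, 0 ≤ φ x) (h1 : ∀ x, φ x ≤ 1) :
    AffineMinorant c (φ * a + (1 - φ) * a')
      (φ.comp ContinuousMap.fst * b + (1 - φ.comp ContinuousMap.fst) * b') := by
  intro x m
  have hint (f : C(X × Y, ℝ)) : Integrable (fun y => f (x, y)) (m : Measure Y) :=
    (f.curry x).integrable_of_compactSpace _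
  have e : ∫ y, (φ.comp ContinuousMap.fst * b + (1 - φ.comp ContinuousMap.fst) * b' :
      C(X × Y, ℝ)) (x, y) ∂(m : Measure Y) = φ x * (∫ y, b (x, y) ∂(m : Measure Y)) +
        (1 - φ x) * ∫ y, b' (x, y) ∂(m : Measure Y) := by
    rw [← integral_const_mul, ← integral_const_mul,
      ← integral_add ((hint b).const_mul _) ((hint b').const_mul _)]
    rfl
  have e' : (φ * a + (1 - φ) * a') x = φ x * a x + (1 - φ x) * a' x := rfl
  rw [e, e']
  nlinarith [mul_le_mul_of_nonneg_left (h x m) (h0 x),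
    mul_le_mul_of_nonneg_left (h' x m) (sub_nonneg.2 (h1 x))]

theorem condIntegral_combination (π : ProbabilityMeasure (X × Y)) (b b' : C(X × Y, ℝ))
    (φ : C(X, ℝ)) (x : X) :
    condIntegral π (φ.comp ContinuousMap.fst * b + (1 - φ.comp ContinuousMap.fst) * b') x =
      φ x * condIntegral π b x + (1 - φ x) * condIntegral π b' x := by
  have hint (f : C(X × Y, ℝ)) :
      Integrable (fun y => f (x, y)) ((π : Measure (X × Y)).condKernel x) :=
    (f.curry x).integrable_of_compactSpace _
  simp only [condIntegral]
  rw [← integral_const_mul, ← integral_const_mul,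
    ← integral_add ((hint b).const_mul _) ((hint b').const_mul _)]
  rfl

theorem barI_le_of_forall_affineMinorant {c : X → FiniteMeasure Y → ℝ} (hA : AssumpA c)
    (μ : Measure X) [IsFiniteMeasure μ] (π : ProbabilityMeasure (X × Y)) {r : ℝ}
    (hr : ∀ a b, AffineMinorant c a b →
      (∫ z, b z ∂(π : Measure (X × Y))) + ∫ x, a x ∂μ ≤ r) :
    barI c μ π ≤ r := by
  obtain ⟨a, b, hab⟩ := hA
  have hmin (k : ℕ) : AffineMinorant c (a k) (b k) := fun x m => (hab x m).1 ⟨k, rfl⟩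
  set πs : Measure X := (π : Measure (X × Y)).fst.singularPart μ with hπs
  obtain ⟨T, hT, hTs, hTμ⟩ := Measure.mutuallySingular_singularPart (π : Measure (X × Y)).fst μ
  set α : X → ℝ := fun x =>
    T.indicator (fun x => ((π : Measure (X × Y)).fst.rnDeriv μ x).toReal) x +
      Tᶜ.indicator (fun _ => 1) x with hα
  set β : X → ℝ := T.indicator fun _ => 1 with hβ
  have hαm : Measurable α :=
    ((Measure.measurable_rnDeriv _ _).ennreal_toReal.indicator hT).add
      (measurable_const.indicator hT.compl)
  have hβm : Measurable β := measurable_const.indicator hT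
  set G : C(X, ℝ) → C(X × Y, ℝ) → X → ℝ := fun a b x => α x * condIntegral π b x + β x * a x
  have hGm (a : C(X, ℝ)) (b : C(X × Y, ℝ)) : Measurable (G a b) :=
    (hαm.mul (measurable_condIntegral π b)).add (hβm.mul a.continuous.measurable)
  have hμT : ∀ᵐ x ∂μ, x ∈ T := hTμ
  have hsT : ∀ᵐ x ∂πs, x ∉ T := measure_eq_zero_iff_ae_notMem.1 hTs
  have hGμ : ∀ᵐ x ∂μ, ∀ a b, G a b x =
      ((π : Measure (X × Y)).fst.rnDeriv μ x).toReal * condIntegral π b x + a x := by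
    filter_upwards [hμT] with x hx a b
    simp [G, hα, hβ, hx]
  have hGs : ∀ᵐ x ∂πs, ∀ (a : C(X, ℝ)) b, G a b x = condIntegral π b x := by
    filter_upwards [hsT] with x hx a b
    simp [G, hα, hβ, hx]
  have hiμ (a : C(X, ℝ)) (b : C(X × Y, ℝ)) : Integrable (G a b) μ :=
    ((integrable_rnDeriv_mul_condIntegral μ π b).add (a.integrable_of_compactSpace μ)).congr
      (by filter_upwards [hGμ] with x hx using (hx a b).symm)
  have his (a : C(X, ℝ)) (b : C(X × Y, ℝ)) : Integrable (G a b) πs :=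
    (integrable_condIntegral π b πs).congr
      (by filter_upwards [hGs] with x hx using (hx a b).symm)
  have hi (a : C(X, ℝ)) (b : C(X × Y, ℝ)) : Integrable (G a b) (μ + πs) :=
    (hiμ a b).add_measure (his a b)
  have hGint (a : C(X, ℝ)) (b : C(X × Y, ℝ)) : ∫ x, G a b x ∂(μ + πs) =
      (∫ z, b z ∂(π : Measure (X × Y))) + ∫ x, a x ∂μ := by
    rw [integral_add_measure (hiμ a b) (his a b),
      integral_eq_integral_rnDeriv_add_integral_singularPart μ, add_right_comm,
      ← integral_add (integrable_rnDeriv_mul_condIntegral μ π b) (a.integrable_of_compactSpace μ)]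
    congr 1 <;> refine integral_congr_ae ?_
    · filter_upwards [hGμ] with x hx using hx a b
    · filter_upwards [hGs] with x hx using hx a b
  have happrox (n : ℕ) {ε : ℝ} (hε : 0 < ε) :=
    exists_integral_abs_partialSups_sub_le (μ + πs)
      (S := {g | ∃ a b, AffineMinorant c a b ∧ g = G a b})
      (by rintro _ ⟨a, b, -, rfl⟩; exact hGm a b) (by rintro _ ⟨a, b, -, rfl⟩; exact hi a b)
      (by
        rintro _ ⟨a, b, h, rfl⟩ _ ⟨a', b', h', rfl⟩ φ h0 h1
        refine ⟨_, _, h.combination h' h0 h1, funext fun x => ?_⟩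
        simp only [G, condIntegral_combination]
        change _ = _ + β x * (φ x * a x + (1 - φ x) * a' x)
        ring)
      (f := fun k => G (a k) (b k)) (fun k => ⟨a k, b k, hmin k, rfl⟩) n hε
  obtain ⟨F, hFi, hFr, hF⟩ := exists_isLUB_integral_le_of_partialSups
    (f := fun k => G (a k) (b k)) (σ := μ + πs) (r := r) (fun k => hGm _ _)
    (fun n => (happrox n one_pos).1) fun n => by
      refine le_of_forall_pos_le_add fun ε hε => ?_
      obtain ⟨hpi, _, ⟨a', b', h', rfl⟩, hle⟩ := happrox n hε
      have h1 := hr a' b' h'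
      rw [← hGint] at h1
      have h2 := integral_mono (hpi.sub (hi a' b')) (hpi.sub (hi a' b')).abs
        fun x => le_abs_self _
      have h3 := integral_sub' hpi (hi a' b')
      simp only [Pi.sub_apply] at h2 h3
      linarith
  have hFiμ : Integrable F μ := hFi.left_of_add_measure
  have hFis : Integrable F πs := hFi.right_of_add_measure
  rw [ae_add_measure_iff] at hF
  have e1 : eintegralR μ (fun x => c x (fiber μ π x)) = ((∫ x, F x ∂μ : ℝ) : EReal) := by
    refine eintegral_eq_coe_integral hFiμ ?_
    filter_upwards [hF.1, hGμ] with x hx hG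
    simp only [hG, ← integral_fiber_s4] at hx
    exact congrArg _ ((hab x _).unique hx)
  have e2 : eintegral πs (fun x => recession c x (condFM π x)) =
      ((∫ x, F x ∂πs : ℝ) : EReal) := by
    refine eintegral_eq_coe_integral hFis ?_
    filter_upwards [hF.2, hGs] with x hx hG
    simp only [hG, ← integral_condFM] at hx
    exact recession_eq_of_isLUB hab hx
  rw [barI, e1, ← hπs, e2, ← EReal.coe_add, ← integral_add_measure hFiμ hFis]
  exact EReal.coe_le_coe_iff.2 hFr

theorem tendsto_integral_of_tendsto {Z ι : Type*} [TopologicalSpace Z] [CompactSpace Z]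
    [MeasurableSpace Z] [OpensMeasurableSpace Z] {l : Filter ι} {p : ι → ProbabilityMeasure Z}
    {q : ProbabilityMeasure Z} (h : Tendsto p l (𝓝 q)) (f : C(Z, ℝ)) :
    Tendsto (fun n => ∫ z, f z ∂(p n : Measure Z)) l (𝓝 (∫ z, f z ∂(q : Measure Z))) :=
  ProbabilityMeasure.tendsto_iff_forall_integral_tendsto.1 h (BoundedContinuousFunction.mkOfCompact f)

end Compact

/-- Proposition `prop:tildeIsci`: under Assumption (A), the functional
`(μ,ν) ↦ bar 𝓘_c(μ,ν)` is (sequentially) lower semicontinuous at every point `(μ,ν)`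
with `Supp(μ) = X`. -/
theorem barTC_lsc_of_full_support
    [CompactSpace X] [CompactSpace Y]
    (c : X → FiniteMeasure Y → ℝ) (hc : IsCost c) (hA : AssumpA c)
    (μ : ProbabilityMeasure X) (ν : ProbabilityMeasure Y)
    (hsupp : msupport (μ : Measure X) = univ)
    (μs : ℕ → ProbabilityMeasure X) (νs : ℕ → ProbabilityMeasure Y)
    (hμs : Tendsto μs atTop (𝓝 μ)) (hνs : Tendsto νs atTop (𝓝 ν)) :
    barTC c (μ : Measure X) (ν : Measure Y) ≤
      liminf (fun n => barTC c (μs n : Measure X) (νs n : Measure Y)) atTop := by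
  by_contra! hlt
  obtain ⟨r, hr, hrlt⟩ := EReal.lt_iff_exists_real_btwn.1 hlt
  have hfreq := frequently_lt_of_liminf_lt (by isBoundedDefault) hr
  have hex (n : ℕ) : ∃ π : ProbabilityMeasure (X × Y),
      barTC c (μs n : Measure X) (νs n : Measure Y) < r →
        (π : Measure (X × Y)).snd = νs n ∧ barI c (μs n : Measure X) π < r := by
    by_cases h : barTC c (μs n : Measure X) (νs n : Measure Y) < r
    · obtain ⟨_, ⟨π, hπ, rfl⟩, hlt⟩ := sInf_lt_iff.1 h
      exact ⟨π, fun _ => ⟨hπ.2, hlt⟩⟩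
    · exact ⟨(μs n).prod (νs n), fun h' => absurd h' h⟩
  choose p hp using hex
  set l : Filter ℕ :=
    atTop ⊓ 𝓟 {n | barTC c (μs n : Measure X) (νs n : Measure Y) < r}
  have : NeBot l := frequently_mem_iff_neBot.1 hfreq
  set u : Ultrafilter ℕ := Ultrafilter.of l
  have hul : (u : Filter ℕ) ≤ l := Ultrafilter.of_le l
  have hu : (u : Filter ℕ) ≤ atTop := hul.trans inf_le_left
  have hup : ∀ᶠ n in (u : Filter ℕ),
      (p n : Measure (X × Y)).snd = νs n ∧ barI c (μs n : Measure X) (p n) < r := by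
    filter_upwards [hul (mem_inf_of_right (mem_principal_self _))] with n hn using hp n hn
  obtain ⟨π, hπ⟩ : ∃ π, Tendsto p u (𝓝 π) := ⟨_, (u.map p).le_nhds_lim⟩
  have hsnd : (π : Measure (X × Y)).snd = ν := by
    have h1 := ProbabilityMeasure.tendsto_map_of_tendsto_of_continuous p π hπ continuous_snd
    have h2 : π.map continuous_snd.measurable.aemeasurable = ν := by
      refine tendsto_nhds_unique h1 ((hνs.mono_left hu).congr' ?_)
      filter_upwards [hup] with n hn
      exact Subtype.ext hn.1.symm
    exact congrArg Subtype.val h2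
  have hle : barI c (μ : Measure X) π ≤ r := by
    refine barI_le_of_forall_affineMinorant hA _ π fun a b hab => ?_
    refine le_of_tendsto ((tendsto_integral_of_tendsto hπ b).add
      (tendsto_integral_of_tendsto (hμs.mono_left hu) a)) ?_
    filter_upwards [hup] with n hn
    exact EReal.coe_le_coe_iff.1 ((hab.le_barI (μs n : Measure X) (p n)).trans hn.2.le)
  have hmem : MemPiSupp (μ : Measure X) (ν : Measure Y) π :=
    ⟨by rw [hsupp]; exact measure_univ, hsnd⟩
  have hbar : barTC c (μ : Measure X) (ν : Measure Y) ≤ barI c (μ : Measure X) π :=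
    sInf_le ⟨π, hmem, rfl⟩
  exact (hrlt.trans_le (hbar.trans hle)).false

end UWOT
end
end
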